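/- Let K > 0 and let S be a set of classical symbols with constant coefficients on ℝⁿ (n ≥ 2) that is stable under the translations σ ↦ σ(· + η) for all η ∈ ℝⁿ and under the partial derivatives ∂_{ξ_j}, and which contains all classical symbols of order with real part < −K. Let ρ be a linear form on the linear span of S such that ρ(∂_{ξ_j}τ) = 0 whenever τ ∈ S and ∂_{ξ_j}τ has order with real part < −K. Then the following are equivalent: (i) ρ(∂_{ξ_j}σ) = 0 for every σ ∈ S and every j ∈ {1,…,n} (closedness); (ii) ρ(σ(· + η)) = ρ(σ) for every σ ∈ S and every η ∈ ℝⁿ (translation invariance). -/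

import Mathlib

open MeasureTheory Metric Filter Complex
open scoped Topology RealInnerProductSpace Classical

noncomputable section

/-- ℝⁿ with the euclidean norm. -/
abbrev Euc (n : ℕ) := EuclideanSpace ℝ (Fin n)

/-- Partial derivative in the `i`-th coordinate direction. -/
def pd {n : ℕ} (i : Fin n) (f : Euc n → ℂ) : Euc n → ℂ :=
  fun ξ => fderiv ℝ f ξ (EuclideanSpace.single i 1)

/-- Iterated partial derivatives along a list of coordinate directions
(a multi-index `β` corresponds to the lists containing `i` exactly `β i` times). -/
def pdIter {n : ℕ} : List (Fin n) → (Euc n → ℂ) → (Euc n → ℂ)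
  | [], f => f
  | i :: L, f => pd i (pdIter L f)

/-- A smooth cut-off function vanishing near `0` and equal to `1` outside the unit ball. -/
structure IsCutoff {n : ℕ} (χ : Euc n → ℝ) : Prop where
  smooth : ContDiff ℝ (⊤ : ℕ∞) χ
  zero_near : ∃ ε > (0:ℝ), ∀ ξ : Euc n, ‖ξ‖ < ε → χ ξ = 0
  one_far : ∀ ξ : Euc n, 1 ≤ ‖ξ‖ → χ ξ = 1

/-- `σ` is a classical symbol of order `a` with constant coefficients on `ℝⁿ`, with
homogeneous components `σc j` of degree `a - j`. -/
structure IsCS {n : ℕ} (χ : Euc n → ℝ) (a : ℂ) (σ : Euc n → ℂ)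
    (σc : ℕ → Euc n → ℂ) : Prop where
  smooth : ContDiff ℝ (⊤ : ℕ∞) σ
  comp_smooth : ∀ j, ContDiffOn ℝ (⊤ : ℕ∞) (σc j) {(0 : Euc n)}ᶜ
  comp_homog : ∀ (j : ℕ) (t : ℝ), 0 < t → ∀ ξ : Euc n, ξ ≠ 0 →
    σc j (t • ξ) = (t : ℂ) ^ (a - j) * σc j ξ
  estimate : ∀ (N : ℕ) (L : List (Fin n)), ∃ C > (0:ℝ), ∀ ξ : Euc n,
    ‖pdIter L (fun η => σ η - ∑ j ∈ Finset.range N, (χ η : ℂ) * σc j η) ξ‖ ≤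
      C * (1 + ‖ξ‖) ^ (a.re - N - L.length : ℝ)

/-- A smoothing symbol with constant coefficients on `ℝⁿ`. -/
def IsSmoothing {n : ℕ} (σ : Euc n → ℂ) : Prop :=
  ContDiff ℝ (⊤ : ℕ∞) σ ∧
    ∀ (L : List (Fin n)) (M : ℝ), 0 < M → ∃ C > (0:ℝ), ∀ ξ : Euc n,
      ‖pdIter L σ ξ‖ ≤ C * (1 + ‖ξ‖) ^ (-M)

/-- The surface measure on the unit sphere `S^{n-1} ⊂ ℝⁿ`. -/
def sphMeas (n : ℕ) : Measure (sphere (0 : Euc n) 1) :=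
  (volume : Measure (Euc n)).toSphere

/-- The integral of a homogeneous component over the unit sphere. -/
def sphInt {n : ℕ} (f : Euc n → ℂ) : ℂ :=
  ∫ ω : sphere (0 : Euc n) 1, f ↑ω ∂(sphMeas n)

/-- The noncommutative residue of a classical symbol of order `a` with homogeneous
components `σc j` of degree `a - j`. -/
def resCC {n : ℕ} (a : ℂ) (σc : ℕ → Euc n → ℂ) : ℂ :=
  if h : ∃ j : ℕ, a - j = -(n : ℂ) then
    (((2 * Real.pi) ^ (-(n : ℝ) / 2) : ℝ) : ℂ) * sphInt (σc h.choose)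
  else 0

/-- The cut-off regularised integral of a classical symbol of order `a` with homogeneous
components `σc`, computed with an integer `N` such that `Re a - N < -n`. -/
def cutoffInt {n : ℕ} (χ : Euc n → ℝ) (a : ℂ) (σ : Euc n → ℂ)
    (σc : ℕ → Euc n → ℂ) (N : ℕ) : ℂ :=
  (∫ ξ : Euc n, (σ ξ - ∑ j ∈ Finset.range N, (χ ξ : ℂ) * σc j ξ))
  + ∑ j ∈ Finset.range N, ∫ ξ in Metric.ball (0 : Euc n) 1, (χ ξ : ℂ) * σc j ξ
  - ∑ j ∈ Finset.range N,
      if a - j + n ≠ 0 then (a - j + n)⁻¹ * sphInt (σc j) else 0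


section Directional

variable {V F : Type} [NormedAddCommGroup V] [NormedSpace ℝ V] [NormedAddCommGroup F]
  [NormedSpace ℝ F]

/-- The weighted average `∫₀¹ (1 - t)ᵏ / k! • f (ξ + t v) dt` of `f` along the segment from `ξ`
to `ξ + v`, as it occurs in the integral form of Taylor's remainder. -/
def segAvg (k : ℕ) (v : V) (f : V → F) (ξ : V) : F :=
  ∫ t in (0 : ℝ)..1, ((1 - t) ^ k / (k.factorial : ℝ)) • f (ξ + t • v)

lemma continuous_segAvg_integrand (k : ℕ) (v : V) {f : V → F} (hf : Continuous f) (ξ : V) :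
    Continuous fun t : ℝ => ((1 - t) ^ k / (k.factorial : ℝ)) • f (ξ + t • v) := by
  fun_prop

lemma abs_segAvg_weight_le (k : ℕ) {t : ℝ} (ht : t ∈ Set.Icc (0 : ℝ) 1) :
    |(1 - t) ^ k / (k.factorial : ℝ)| ≤ 1 := by
  have h0 : 0 ≤ 1 - t := by linarith [ht.2]
  have h1 : (1 - t) ^ k ≤ 1 := pow_le_one₀ h0 (by linarith [ht.1])
  have hk : (1 : ℝ) ≤ k.factorial := by exact_mod_cast Nat.one_le_iff_ne_zero.2 k.factorial_ne_zero
  rw [abs_of_nonneg (by positivity)]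
  exact div_le_one_of_le₀ (h1.trans hk) (by positivity)

lemma hasFDerivAt_segAvg [ProperSpace V] (k : ℕ) (v : V) {f : V → F} (hf : ContDiff ℝ 1 f)
    (ξ : V) : HasFDerivAt (segAvg k v f) (segAvg k v (fderiv ℝ f) ξ) ξ := by
  have hf' : Continuous (fderiv ℝ f) := hf.continuous_fderiv one_ne_zero
  obtain ⟨C, hC⟩ := (isCompact_closedBall (0 : V) (‖ξ‖ + 1 + ‖v‖)).exists_bound_of_continuousOn
    hf'.continuousOn
  refine intervalIntegral.hasFDerivAt_integral_of_dominated_of_fderiv_le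
    (F := fun x t => ((1 - t) ^ k / (k.factorial : ℝ)) • f (x + t • v))
    (F' := fun x t => ((1 - t) ^ k / (k.factorial : ℝ)) • fderiv ℝ f (x + t • v))
    (bound := fun _ => C) (Metric.ball_mem_nhds ξ one_pos) ?_ ?_ ?_ ?_ ?_ ?_
  · exact Eventually.of_forall fun x =>
      (continuous_segAvg_integrand k v hf.continuous x).aestronglyMeasurable
  · exact (continuous_segAvg_integrand k v hf.continuous ξ).intervalIntegrable _ _
  · exact (continuous_segAvg_integrand k v hf' ξ).aestronglyMeasurable
  · refine Eventually.of_forall fun t ht x hx => ?_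
    rw [Set.uIoc_of_le zero_le_one] at ht
    have htI : t ∈ Set.Icc (0 : ℝ) 1 := ⟨ht.1.le, ht.2⟩
    have hx' : x + t • v ∈ closedBall (0 : V) (‖ξ‖ + 1 + ‖v‖) := by
      rw [mem_closedBall_zero_iff]
      have h1 : ‖x‖ ≤ ‖ξ‖ + 1 := by
        have := norm_le_norm_add_norm_sub' x ξ
        rw [mem_ball_iff_norm] at hx
        linarith
      have h2 : ‖t • v‖ ≤ ‖v‖ := by
        rw [norm_smul, Real.norm_of_nonneg htI.1]
        exact mul_le_of_le_one_left (norm_nonneg _) htI.2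
      linarith [norm_add_le x (t • v)]
    rw [norm_smul, Real.norm_eq_abs]
    exact (mul_le_of_le_one_left (norm_nonneg _) (abs_segAvg_weight_le k htI)).trans (hC _ hx')
  · exact intervalIntegrable_const
  · refine Eventually.of_forall fun t _ x _ => ?_
    have h1 : HasFDerivAt f (fderiv ℝ f (x + t • v)) (x + t • v) :=
      (hf.differentiable one_ne_zero _).hasFDerivAt
    have h2 : HasFDerivAt (fun y : V => f (y + t • v)) (fderiv ℝ f (x + t • v)) x := by
      simpa [Function.comp_def] using h1.comp x ((hasFDerivAt_id x).add_const (t • v))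
    exact h2.const_smul _

lemma hasDerivAt_comp_segment {f : V → F} (hf : ContDiff ℝ 1 f) (ξ v : V) (t : ℝ) :
    HasDerivAt (fun t : ℝ => f (ξ + t • v)) (fderiv ℝ f (ξ + t • v) v) t := by
  have h1 : HasDerivAt (fun t : ℝ => ξ + t • v) v t := by
    simpa using ((hasDerivAt_id t).smul_const v).const_add ξ
  exact (hf.differentiable one_ne_zero _).hasFDerivAt.comp_hasDerivAt t h1

/-- Translation as a first order Taylor formula. -/
lemma translate_eq_add_segAvg [CompleteSpace F] {f : V → F} (hf : ContDiff ℝ 1 f) (ξ v : V) :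
    f (ξ + v) = f ξ + segAvg 0 v (fun x => fderiv ℝ f x v) ξ := by
  have hc : Continuous fun x => fderiv ℝ f x v :=
    (hf.continuous_fderiv one_ne_zero).clm_apply continuous_const
  have := intervalIntegral.integral_eq_sub_of_hasDerivAt (a := 0) (b := 1)
    (fun t _ => hasDerivAt_comp_segment hf ξ v t)
    ((hc.comp (by fun_prop : Continuous fun t : ℝ => ξ + t • v)).intervalIntegrable _ _)
  simp only [segAvg, pow_zero, Nat.factorial_zero, Nat.cast_one, div_one, one_smul]
  simp only [one_smul, zero_smul, add_zero] at this
  rw [this]; abel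

/-- Integration by parts for the averages along segments. -/
lemma segAvg_eq_add_segAvg_succ [CompleteSpace F] {f : V → F} (hf : ContDiff ℝ 1 f) (k : ℕ)
    (ξ v : V) :
    segAvg k v f ξ = ((k + 1).factorial : ℝ)⁻¹ • f ξ +
      segAvg (k + 1) v (fun x => fderiv ℝ f x v) ξ := by
  have hc : Continuous fun x => fderiv ℝ f x v :=
    (hf.continuous_fderiv one_ne_zero).clm_apply continuous_const
  have hw : ∀ t : ℝ, HasDerivAt (fun t : ℝ => -((1 - t) ^ (k + 1) / ((k + 1).factorial : ℝ)))
      ((1 - t) ^ k / (k.factorial : ℝ)) t := by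
    intro t
    have h := ((((hasDerivAt_id t).const_sub 1).pow (k + 1)).div_const
      ((k + 1).factorial : ℝ)).neg
    refine h.congr_deriv ?_
    have : (k.factorial : ℝ) ≠ 0 := by exact_mod_cast k.factorial_ne_zero
    simp only [Nat.factorial_succ, id, Nat.add_sub_cancel]
    push_cast
    field_simp
  have h1 := continuous_segAvg_integrand k v hf.continuous ξ
  have h2 := continuous_segAvg_integrand (k + 1) v hc ξ
  have := intervalIntegral.integral_eq_sub_of_hasDerivAt (a := 0) (b := 1)
    (f' := fun t => ((1 - t) ^ k / (k.factorial : ℝ)) • f (ξ + t • v) -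
      ((1 - t) ^ (k + 1) / ((k + 1).factorial : ℝ)) • fderiv ℝ f (ξ + t • v) v)
    (fun t _ => ((hw t).smul (hasDerivAt_comp_segment hf ξ v t)).congr_deriv (by
      rw [neg_smul]; abel))
    ((h1.sub h2).intervalIntegrable _ _)
  rw [intervalIntegral.integral_sub (h1.intervalIntegrable _ _) (h2.intervalIntegrable _ _),
    sub_eq_iff_eq_add] at this
  unfold segAvg
  rw [this]
  simp

end Directional

lemma contDiff_segAvg {V : Type} [NormedAddCommGroup V] [NormedSpace ℝ V] [ProperSpace V]
    (k : ℕ) (v : V) {F : Type} [NormedAddCommGroup F] [NormedSpace ℝ F] {f : V → F}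
    (hf : ContDiff ℝ (⊤ : ℕ∞) f) : ContDiff ℝ (⊤ : ℕ∞) (segAvg k v f) := by
  rw [contDiff_infty]
  intro m
  induction m generalizing F with
  | zero =>
    have hf1 : ContDiff ℝ 1 f := hf.of_le (by exact_mod_cast le_top)
    exact contDiff_zero.2 (continuous_iff_continuousAt.2 fun ξ =>
      (hasFDerivAt_segAvg k v hf1 ξ).continuousAt)
  | succ m ih =>
    have hf1 : ContDiff ℝ 1 f := hf.of_le (by exact_mod_cast le_top)
    push_cast
    rw [contDiff_succ_iff_fderiv]
    refine ⟨fun ξ => (hasFDerivAt_segAvg k v hf1 ξ).differentiableAt, by simp, ?_⟩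
    have : fderiv ℝ (segAvg k v f) = segAvg k v (fderiv ℝ f) :=
      funext fun ξ => (hasFDerivAt_segAvg k v hf1 ξ).fderiv
    rw [this]
    exact ih (hf.fderiv_right (by simp))

section PartialDerivatives

variable {n : ℕ} {f g : Euc n → ℂ}

lemma ContDiff.pd (hf : ContDiff ℝ (⊤ : ℕ∞) f) (j : Fin n) : ContDiff ℝ (⊤ : ℕ∞) (pd j f) :=
  (hf.fderiv_right (m := (⊤ : ℕ∞)) (by simp)).clm_apply contDiff_const

lemma ContDiff.pd_iterate (hf : ContDiff ℝ (⊤ : ℕ∞) f) (j : Fin n) (i : ℕ) :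
    ContDiff ℝ (⊤ : ℕ∞) ((_root_.pd j)^[i] f) := by
  induction i with
  | zero => exact hf
  | succ i ih => rw [Function.iterate_succ_apply']; exact ih.pd j

lemma ContDiff.pdIter (hf : ContDiff ℝ (⊤ : ℕ∞) f) (L : List (Fin n)) :
    ContDiff ℝ (⊤ : ℕ∞) (pdIter L f) := by
  induction L with
  | nil => exact hf
  | cons i L ih => exact ih.pd i

lemma ContDiff.differentiable_top (hf : ContDiff ℝ (⊤ : ℕ∞) f) : Differentiable ℝ f :=
  hf.differentiable (by simp)

lemma pd_add (hf : ContDiff ℝ (⊤ : ℕ∞) f) (hg : ContDiff ℝ (⊤ : ℕ∞) g) (j : Fin n) :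
    pd j (fun ξ => f ξ + g ξ) = fun ξ => pd j f ξ + pd j g ξ := by
  funext ξ
  simp only [pd]
  rw [fderiv_fun_add (hf.differentiable_top ξ) (hg.differentiable_top ξ)]
  rfl

lemma pd_const_mul (hf : ContDiff ℝ (⊤ : ℕ∞) f) (c : ℂ) (j : Fin n) :
    pd j (fun ξ => c * f ξ) = fun ξ => c * pd j f ξ := by
  funext ξ
  simp only [pd]
  rw [fderiv_const_mul (hf.differentiable_top ξ)]
  rfl

lemma pdIter_add (hf : ContDiff ℝ (⊤ : ℕ∞) f) (hg : ContDiff ℝ (⊤ : ℕ∞) g)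
    (L : List (Fin n)) :
    pdIter L (fun ξ => f ξ + g ξ) = fun ξ => pdIter L f ξ + pdIter L g ξ := by
  induction L with
  | nil => rfl
  | cons i L ih => simp only [pdIter]; rw [ih, pd_add (hf.pdIter L) (hg.pdIter L)]

lemma pdIter_const_mul (hf : ContDiff ℝ (⊤ : ℕ∞) f) (c : ℂ) (L : List (Fin n)) :
    pdIter L (fun ξ => c * f ξ) = fun ξ => c * pdIter L f ξ := by
  induction L with
  | nil => rfl
  | cons i L ih => simp only [pdIter]; rw [ih, pd_const_mul (hf.pdIter L)]

lemma pdIter_append_singleton (L : List (Fin n)) (j : Fin n) (f : Euc n → ℂ) :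
    pdIter (L ++ [j]) f = pdIter L (pd j f) := by
  induction L with
  | nil => rfl
  | cons i L ih => simp only [List.cons_append, pdIter, ih]

lemma pd_eq_zero_of_eventuallyEq {ξ : Euc n} (h : f =ᶠ[𝓝 ξ] fun _ => 0) (j : Fin n) :
    pd j f ξ = 0 := by
  simp only [pd]
  rw [h.fderiv_eq]
  simp

lemma pdIter_eq_zero_of_isOpen {U : Set (Euc n)} (hU : IsOpen U) (h : ∀ ξ ∈ U, f ξ = 0)
    (L : List (Fin n)) : ∀ ξ ∈ U, pdIter L f ξ = 0 := by
  induction L with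
  | nil => exact h
  | cons i L ih =>
    intro ξ hξ
    exact pd_eq_zero_of_eventuallyEq
      (Filter.eventuallyEq_of_mem (hU.mem_nhds hξ) ih) i

lemma pd_segAvg (hf : ContDiff ℝ (⊤ : ℕ∞) f) (j : Fin n) (k : ℕ) (v : Euc n) :
    pd j (segAvg k v f) = segAvg k v (pd j f) := by
  have hf1 : ContDiff ℝ 1 f := hf.of_le (by exact_mod_cast le_top)
  funext ξ
  simp only [pd]
  rw [(hasFDerivAt_segAvg k v hf1 ξ).fderiv]
  unfold segAvg
  rw [ContinuousLinearMap.intervalIntegral_apply]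
  · rfl
  · exact (continuous_segAvg_integrand k v (hf1.continuous_fderiv one_ne_zero) ξ).intervalIntegrable
      _ _

lemma pdIter_segAvg (hf : ContDiff ℝ (⊤ : ℕ∞) f) (L : List (Fin n)) (k : ℕ) (v : Euc n) :
    pdIter L (segAvg k v f) = segAvg k v (pdIter L f) := by
  induction L with
  | nil => rfl
  | cons i L ih => simp only [pdIter]; rw [ih, pd_segAvg (hf.pdIter L)]

lemma fderiv_apply_single (f : Euc n → ℂ) (j : Fin n) (s : ℝ) (ξ : Euc n) :
    fderiv ℝ f ξ (EuclideanSpace.single j s) = s * pd j f ξ := by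
  have : (EuclideanSpace.single j s : Euc n) = s • EuclideanSpace.single j (1 : ℝ) := by
    ext i
    simp
  rw [this, map_smul]
  simp [pd]

lemma segAvg_const_mul (k : ℕ) (v : Euc n) (c : ℂ) (f : Euc n → ℂ) (ξ : Euc n) :
    segAvg k v (fun x => c * f x) ξ = c * segAvg k v f ξ := by
  unfold segAvg
  rw [← intervalIntegral.integral_const_mul]
  congr 1
  funext t
  simp only [Complex.real_smul]
  ring

lemma segAvg_single_eq (hf : ContDiff ℝ (⊤ : ℕ∞) f) (j : Fin n) (s : ℝ) (k : ℕ) (ξ : Euc n) :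
    segAvg k (EuclideanSpace.single j s) f ξ =
      ((k + 1).factorial : ℂ)⁻¹ * f ξ +
        s * segAvg (k + 1) (EuclideanSpace.single j s) (pd j f) ξ := by
  rw [segAvg_eq_add_segAvg_succ (hf.of_le (by exact_mod_cast le_top))]
  simp only [fderiv_apply_single, segAvg_const_mul, Complex.real_smul]
  push_cast
  rfl

/-- Expansion of the averages in the direction of a coordinate axis. -/
lemma segAvg_single_expansion (hf : ContDiff ℝ (⊤ : ℕ∞) f) (j : Fin n) (s : ℝ) (k N : ℕ)
    (ξ : Euc n) :
    segAvg k (EuclideanSpace.single j s) f ξ =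
      ∑ i ∈ Finset.range N, (s ^ i / ((k + 1 + i).factorial : ℂ)) * (pd j)^[i] f ξ +
        s ^ N * segAvg (k + N) (EuclideanSpace.single j s) ((pd j)^[N] f) ξ := by
  induction N with
  | zero => simp
  | succ N ih =>
    rw [ih, segAvg_single_eq (hf.pd_iterate j N), Finset.sum_range_succ,
      Function.iterate_succ_apply', show k + N + 1 = k + 1 + N by ring,
      show k + (N + 1) = k + 1 + N by ring]
    ring

/-- Taylor's formula along a coordinate axis. -/
lemma translate_single_expansion (hf : ContDiff ℝ (⊤ : ℕ∞) f) (j : Fin n) (s : ℝ) (N : ℕ)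
    (ξ : Euc n) :
    f (ξ + EuclideanSpace.single j s) =
      ∑ i ∈ Finset.range (N + 1), (s ^ i / (i.factorial : ℂ)) * (pd j)^[i] f ξ +
        s ^ (N + 1) * pd j (segAvg N (EuclideanSpace.single j s) ((pd j)^[N] f)) ξ := by
  rw [translate_eq_add_segAvg (hf.of_le (by exact_mod_cast le_top))]
  simp only [fderiv_apply_single, segAvg_const_mul]
  rw [segAvg_single_expansion (hf.pd j) j s 0 N, Finset.sum_range_succ',
    pd_segAvg (hf.pd_iterate j N), ← Function.iterate_succ_apply' (pd j), mul_add, Finset.mul_sum]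
  simp only [← Function.iterate_succ_apply (pd j), zero_add, pow_zero, Nat.factorial_zero,
    Nat.cast_one, Function.iterate_zero, id, div_one, one_mul]
  have : ∀ i : ℕ, (s : ℂ) * (s ^ i / ((1 + i).factorial : ℂ) * (pd j)^[i + 1] f ξ) =
      s ^ (i + 1) / ((i + 1).factorial : ℂ) * (pd j)^[i + 1] f ξ := by
    intro i
    rw [add_comm 1 i]
    ring
  simp only [Nat.succ_eq_add_one, this]
  ring

end PartialDerivatives

/-- Smooth functions satisfying the symbol estimates of (real) order `r`. -/
structure IsSymbol {n : ℕ} (r : ℝ) (f : Euc n → ℂ) : Prop where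
  smooth : ContDiff ℝ (⊤ : ℕ∞) f
  bound : ∀ L : List (Fin n), ∃ C : ℝ, ∀ ξ : Euc n,
    ‖pdIter L f ξ‖ ≤ C * (1 + ‖ξ‖) ^ (r - L.length)

namespace IsSymbol

variable {n : ℕ} {r : ℝ} {f g : Euc n → ℂ}

lemma add (hf : IsSymbol r f) (hg : IsSymbol r g) : IsSymbol r (fun ξ => f ξ + g ξ) := by
  refine ⟨hf.smooth.add hg.smooth, fun L => ?_⟩
  obtain ⟨C, hC⟩ := hf.bound L
  obtain ⟨D, hD⟩ := hg.bound L
  refine ⟨C + D, fun ξ => ?_⟩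
  rw [pdIter_add hf.smooth hg.smooth, add_mul]
  exact (norm_add_le _ _).trans (add_le_add (hC ξ) (hD ξ))

lemma const_mul (hf : IsSymbol r f) (c : ℂ) : IsSymbol r (fun ξ => c * f ξ) := by
  refine ⟨contDiff_const.mul hf.smooth, fun L => ?_⟩
  obtain ⟨C, hC⟩ := hf.bound L
  refine ⟨‖c‖ * C, fun ξ => ?_⟩
  rw [pdIter_const_mul hf.smooth, norm_mul, mul_assoc]
  exact mul_le_mul_of_nonneg_left (hC ξ) (norm_nonneg c)

lemma of_eq_zero_of_one_lt_norm (r : ℝ) (hf : ContDiff ℝ (⊤ : ℕ∞) f)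
    (h : ∀ ξ : Euc n, 1 < ‖ξ‖ → f ξ = 0) : IsSymbol r f := by
  refine ⟨hf, fun L => ?_⟩
  have hz := pdIter_eq_zero_of_isOpen (isOpen_lt continuous_const continuous_norm) h L
  have hpos : ∀ ξ : Euc n, 0 < (1 + ‖ξ‖) ^ (r - L.length) := fun ξ => by positivity
  have hcont : Continuous fun ξ : Euc n => ‖pdIter L f ξ‖ / (1 + ‖ξ‖) ^ (r - L.length) :=
    (hf.pdIter L).continuous.norm.div
      ((continuous_const.add continuous_norm).rpow_const fun ξ =>
        Or.inl (add_pos_of_pos_of_nonneg one_pos (norm_nonneg ξ)).ne')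
      fun ξ => (hpos ξ).ne'
  obtain ⟨C, hC⟩ := (isCompact_closedBall (0 : Euc n) 1).exists_bound_of_continuousOn
    hcont.continuousOn
  refine ⟨|C|, fun ξ => ?_⟩
  rcases le_or_gt ‖ξ‖ 1 with hξ | hξ
  · rw [← div_le_iff₀ (hpos ξ)]
    exact (le_abs_self _).trans ((hC ξ (by simpa using hξ)).trans (le_abs_self C))
  · rw [hz ξ hξ, norm_zero]
    positivity

lemma zero (r : ℝ) : IsSymbol (n := n) r (fun _ => 0) :=
  of_eq_zero_of_one_lt_norm r contDiff_const fun _ _ => rfl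

lemma sum {ι : Type*} {s : Finset ι} {f : ι → Euc n → ℂ} (hf : ∀ i ∈ s, IsSymbol r (f i)) :
    IsSymbol r (fun ξ => ∑ i ∈ s, f i ξ) := by
  induction s using Finset.induction_on with
  | empty => simpa using zero r
  | insert i s hi ih =>
    simp only [Finset.sum_insert hi]
    exact (hf i (Finset.mem_insert_self i s)).add
      (ih fun k hk => hf k (Finset.mem_insert_of_mem hk))

lemma pd (hf : IsSymbol r f) (j : Fin n) : IsSymbol (r - 1) (pd j f) := by
  refine ⟨hf.smooth.pd j, fun L => ?_⟩
  obtain ⟨C, hC⟩ := hf.bound (L ++ [j])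
  refine ⟨C, fun ξ => ?_⟩
  have := hC ξ
  rw [pdIter_append_singleton, List.length_append, List.length_singleton] at this
  convert this using 3
  push_cast
  ring

end IsSymbol

/-- Peetre's inequality. -/
lemma one_add_norm_add_rpow_le {V : Type*} [SeminormedAddCommGroup V] (ξ w : V) (r : ℝ) :
    (1 + ‖ξ + w‖) ^ r ≤ (1 + ‖w‖) ^ |r| * (1 + ‖ξ‖) ^ r := by
  have key : ∀ x y : V, 1 + ‖x + y‖ ≤ (1 + ‖y‖) * (1 + ‖x‖) := fun x y => by
    nlinarith [norm_add_le x y, norm_nonneg x, norm_nonneg y]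
  rcases le_total 0 r with hr | hr
  · rw [abs_of_nonneg hr, ← Real.mul_rpow (add_nonneg zero_le_one (norm_nonneg _))
      (add_nonneg zero_le_one (norm_nonneg _))]
    exact Real.rpow_le_rpow (by positivity) (key ξ w) hr
  · have h := Real.rpow_le_rpow (add_nonneg zero_le_one (norm_nonneg _)) (key (ξ + w) (-w))
      (neg_nonneg.2 hr)
    rw [add_neg_cancel_right, norm_neg,
      Real.mul_rpow (by positivity : (0 : ℝ) ≤ 1 + ‖w‖) (by positivity : (0 : ℝ) ≤ 1 + ‖ξ + w‖),
      Real.rpow_neg (by positivity : (0 : ℝ) ≤ 1 + ‖ξ‖),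
      Real.rpow_neg (by positivity : (0 : ℝ) ≤ 1 + ‖ξ + w‖)] at h
    rw [abs_of_nonpos hr]
    have h1 : 0 < (1 + ‖ξ‖) ^ r := by positivity
    have h2 : 0 < (1 + ‖ξ + w‖) ^ r := by positivity
    rwa [← div_eq_mul_inv, le_div_iff₀ h2, inv_mul_le_iff₀ h1, mul_comm _ ((1 + ‖w‖) ^ (-r))]
      at h

lemma IsSymbol.segAvg {n : ℕ} {r : ℝ} {f : Euc n → ℂ} (hf : IsSymbol r f) (k : ℕ) (v : Euc n) :
    IsSymbol r (segAvg k v f) := by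
  refine ⟨contDiff_segAvg k v hf.smooth, fun L => ?_⟩
  obtain ⟨C, hC⟩ := hf.bound L
  refine ⟨|C| * (1 + ‖v‖) ^ |r - L.length|, fun ξ => ?_⟩
  rw [pdIter_segAvg hf.smooth]
  have := intervalIntegral.norm_integral_le_of_norm_le_const (a := (0 : ℝ)) (b := 1)
    (f := fun t : ℝ => ((1 - t) ^ k / (k.factorial : ℝ)) • pdIter L f (ξ + t • v))
    (C := |C| * (1 + ‖v‖) ^ |r - L.length| * (1 + ‖ξ‖) ^ (r - L.length)) fun t ht => by
      rw [Set.uIoc_of_le zero_le_one] at ht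
      have htI : t ∈ Set.Icc (0 : ℝ) 1 := ⟨ht.1.le, ht.2⟩
      have h2 : ‖t • v‖ ≤ ‖v‖ := by
        rw [norm_smul, Real.norm_of_nonneg htI.1]
        exact mul_le_of_le_one_left (norm_nonneg _) htI.2
      rw [norm_smul, Real.norm_eq_abs]
      calc _ ≤ ‖pdIter L f (ξ + t • v)‖ :=
            mul_le_of_le_one_left (norm_nonneg _) (abs_segAvg_weight_le k htI)
        _ ≤ C * (1 + ‖ξ + t • v‖) ^ (r - L.length) := hC _
        _ ≤ |C| * (1 + ‖ξ + t • v‖) ^ (r - L.length) := by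
            gcongr
            exact le_abs_self C
        _ ≤ |C| * ((1 + ‖t • v‖) ^ |r - L.length| * (1 + ‖ξ‖) ^ (r - L.length)) := by
            gcongr
            exact one_add_norm_add_rpow_le _ _ _
        _ ≤ |C| * ((1 + ‖v‖) ^ |r - L.length| * (1 + ‖ξ‖) ^ (r - L.length)) := by
            gcongr
        _ = _ := by ring
  simpa [_root_.segAvg] using this

section Cutoff

variable {n : ℕ}

lemma contDiff_mul_of_zero_near {u h : Euc n → ℂ} (hu : ContDiff ℝ (⊤ : ℕ∞) u)
    (hu0 : u =ᶠ[𝓝 0] fun _ => 0) (hh : ContDiffOn ℝ (⊤ : ℕ∞) h {(0 : Euc n)}ᶜ) :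
    ContDiff ℝ (⊤ : ℕ∞) (fun ξ => u ξ * h ξ) := by
  rw [contDiff_iff_contDiffAt]
  intro ξ
  by_cases hξ : ξ = 0
  · subst hξ
    refine (contDiffAt_const (c := (0 : ℂ))).congr_of_eventuallyEq ?_
    filter_upwards [hu0] with x hx
    rw [hx, zero_mul]
  · exact hu.contDiffAt.mul (hh.contDiffAt (isOpen_compl_singleton.mem_nhds hξ))

lemma pd_mul_of_zero_near {u h : Euc n → ℂ} (hu : ContDiff ℝ (⊤ : ℕ∞) u)
    (hu0 : u =ᶠ[𝓝 0] fun _ => 0) (hh : ContDiffOn ℝ (⊤ : ℕ∞) h {(0 : Euc n)}ᶜ) (j : Fin n)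
    (ξ : Euc n) :
    pd j (fun ξ => u ξ * h ξ) ξ = u ξ * pd j h ξ + pd j u ξ * h ξ := by
  by_cases hξ : ξ = 0
  · subst hξ
    rw [pd_eq_zero_of_eventuallyEq (f := fun ξ => u ξ * h ξ)
      (by filter_upwards [hu0] with x hx; rw [hx, zero_mul]),
      pd_eq_zero_of_eventuallyEq hu0, hu0.self_of_nhds]
    ring
  · have h1 : DifferentiableAt ℝ h ξ :=
      (hh.contDiffAt (isOpen_compl_singleton.mem_nhds hξ)).differentiableAt (by simp)
    simp only [pd]
    rw [fderiv_fun_mul (hu.differentiable_top ξ) h1]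
    simp [mul_comm]

variable {χ : Euc n → ℝ}

lemma IsCutoff.contDiff_ofReal (hχ : IsCutoff χ) :
    ContDiff ℝ (⊤ : ℕ∞) (fun ξ => (χ ξ : ℂ)) :=
  Complex.ofRealCLM.contDiff.comp hχ.smooth

lemma IsCutoff.ofReal_eventuallyEq_zero (hχ : IsCutoff χ) :
    (fun ξ => (χ ξ : ℂ)) =ᶠ[𝓝 0] fun _ => 0 := by
  obtain ⟨ε, hε, h⟩ := hχ.zero_near
  filter_upwards [Metric.ball_mem_nhds (0 : Euc n) hε] with ξ hξ
  rw [h ξ (by simpa using hξ), Complex.ofReal_zero]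

lemma IsCutoff.pd_eventuallyEq_zero (hχ : IsCutoff χ) (j : Fin n) :
    pd j (fun ξ => (χ ξ : ℂ)) =ᶠ[𝓝 0] fun _ => 0 :=
  hχ.ofReal_eventuallyEq_zero.eventuallyEq_nhds.mono fun _ h => pd_eq_zero_of_eventuallyEq h j

lemma IsCutoff.pd_eq_zero (hχ : IsCutoff χ) (j : Fin n) {ξ : Euc n} (hξ : 1 < ‖ξ‖) :
    pd j (fun ξ => (χ ξ : ℂ)) ξ = 0 := by
  have h : (fun ξ => (χ ξ : ℂ)) =ᶠ[𝓝 ξ] fun _ => 1 := by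
    filter_upwards [(isOpen_lt continuous_const continuous_norm).mem_nhds hξ] with x hx
    rw [hχ.one_far x (le_of_lt hx), Complex.ofReal_one]
  simp only [pd]
  rw [h.fderiv_eq]
  simp

end Cutoff

lemma ContDiffOn.pd {n : ℕ} {h : Euc n → ℂ} (hh : ContDiffOn ℝ (⊤ : ℕ∞) h {(0 : Euc n)}ᶜ)
    (j : Fin n) : ContDiffOn ℝ (⊤ : ℕ∞) (pd j h) {(0 : Euc n)}ᶜ :=
  (hh.fderiv_of_isOpen isOpen_compl_singleton (m := (⊤ : ℕ∞)) (by simp)).clm_apply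
    contDiffOn_const

/-- A partial derivative of a homogeneous function of degree `b` is homogeneous of degree
`b - 1`. -/
lemma pd_homogeneous {n : ℕ} {h : Euc n → ℂ} {b : ℂ}
    (hh : ContDiffOn ℝ (⊤ : ℕ∞) h {(0 : Euc n)}ᶜ)
    (hom : ∀ t : ℝ, 0 < t → ∀ ξ : Euc n, ξ ≠ 0 → h (t • ξ) = (t : ℂ) ^ b * h ξ)
    (j : Fin n) {t : ℝ} (ht : 0 < t) {ξ : Euc n} (hξ : ξ ≠ 0) :
    pd j h (t • ξ) = (t : ℂ) ^ (b - 1) * pd j h ξ := by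
  have hd : ∀ x : Euc n, x ≠ 0 → DifferentiableAt ℝ h x := fun x hx =>
    (hh.contDiffAt (isOpen_compl_singleton.mem_nhds hx)).differentiableAt (by simp)
  have h1 : HasFDerivAt (fun x : Euc n => h (t • x))
      ((fderiv ℝ h (t • ξ)).comp (t • ContinuousLinearMap.id ℝ (Euc n))) ξ :=
    (hd _ (smul_ne_zero ht.ne' hξ)).hasFDerivAt.comp ξ ((hasFDerivAt_id ξ).const_smul t)
  have h2 : HasFDerivAt (fun x : Euc n => (t : ℂ) ^ b * h x) ((t : ℂ) ^ b • fderiv ℝ h ξ) ξ :=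
    (hd ξ hξ).hasFDerivAt.const_mul _
  have h3 : (fun x : Euc n => h (t • x)) =ᶠ[𝓝 ξ] fun x => (t : ℂ) ^ b * h x := by
    filter_upwards [isOpen_compl_singleton.mem_nhds hξ] with x hx
    exact hom t ht x hx
  have h4 := congrArg (fun A : Euc n →L[ℝ] ℂ => A (EuclideanSpace.single j 1))
    ((h1.congr_of_eventuallyEq h3.symm).unique h2)
  have ht0 : (t : ℂ) ≠ 0 := by exact_mod_cast ht.ne'
  simp only [ContinuousLinearMap.comp_apply, _root_.smul_apply,
    ContinuousLinearMap.id_apply, map_smul, Complex.real_smul, smul_eq_mul] at h4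
  rw [Complex.cpow_sub _ _ ht0, Complex.cpow_one]
  simp only [_root_.pd]
  rw [div_mul_eq_mul_div, eq_div_iff ht0, mul_comm, h4]

namespace IsCS

variable {n : ℕ} {χ : Euc n → ℝ} {a : ℂ} {σ : Euc n → ℂ} {σc : ℕ → Euc n → ℂ}

lemma contDiff_cutoff_mul (h : IsCS χ a σ σc) (hχ : IsCutoff χ) (j : ℕ) :
    ContDiff ℝ (⊤ : ℕ∞) (fun ξ => (χ ξ : ℂ) * σc j ξ) :=
  contDiff_mul_of_zero_near hχ.contDiff_ofReal hχ.ofReal_eventuallyEq_zero (h.comp_smooth j)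

lemma isSymbol_remainder (h : IsCS χ a σ σc) (hχ : IsCutoff χ) (N : ℕ) :
    IsSymbol (a.re - N) (fun ξ => σ ξ - ∑ j ∈ Finset.range N, (χ ξ : ℂ) * σc j ξ) :=
  ⟨h.smooth.sub (ContDiff.sum fun j _ => h.contDiff_cutoff_mul hχ j), fun L => by
    obtain ⟨C, -, hC⟩ := h.estimate N L
    exact ⟨C, hC⟩⟩

lemma isSymbol (h : IsCS χ a σ σc) (hχ : IsCutoff χ) : IsSymbol a.re σ := by
  simpa using h.isSymbol_remainder hχ 0

lemma of_isSymbol_remainder (hs : ContDiff ℝ (⊤ : ℕ∞) σ)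
    (hc : ∀ j, ContDiffOn ℝ (⊤ : ℕ∞) (σc j) {(0 : Euc n)}ᶜ)
    (hh : ∀ (j : ℕ) (t : ℝ), 0 < t → ∀ ξ : Euc n, ξ ≠ 0 →
      σc j (t • ξ) = (t : ℂ) ^ (a - j) * σc j ξ)
    (hr : ∀ N : ℕ, IsSymbol (a.re - N)
      (fun ξ => σ ξ - ∑ j ∈ Finset.range N, (χ ξ : ℂ) * σc j ξ)) : IsCS χ a σ σc := by
  refine ⟨hs, hc, hh, fun N L => ?_⟩
  obtain ⟨C, hC⟩ := (hr N).bound L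
  refine ⟨|C| + 1, by positivity, fun ξ => (hC ξ).trans ?_⟩
  gcongr
  linarith [le_abs_self C]

lemma const_mul (h : IsCS χ a σ σc) (hχ : IsCutoff χ) (c : ℂ) :
    IsCS χ a (fun ξ => c * σ ξ) (fun j ξ => c * σc j ξ) := by
  refine of_isSymbol_remainder (contDiff_const.mul h.smooth)
    (fun j => contDiffOn_const.mul (h.comp_smooth j)) (fun j t ht ξ hξ => ?_) fun N => ?_
  · rw [h.comp_homog j t ht ξ hξ]
    ring
  · convert (h.isSymbol_remainder hχ N).const_mul c using 2 with ξ
    rw [mul_sub, Finset.mul_sum]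
    congr 1
    exact Finset.sum_congr rfl fun j _ => by ring

lemma pd (h : IsCS χ a σ σc) (hχ : IsCutoff χ) (j : Fin n) :
    IsCS χ (a - 1) (pd j σ) (fun m => pd j (σc m)) := by
  refine of_isSymbol_remainder (h.smooth.pd j) (fun m => (h.comp_smooth m).pd j)
    (fun m t ht ξ hξ => ?_) fun N => ?_
  · rw [pd_homogeneous (h.comp_smooth m) (h.comp_homog m) j ht hξ, sub_right_comm]
  · have h1 : IsSymbol ((a - 1).re - N) (_root_.pd j
        (fun ξ => σ ξ - ∑ m ∈ Finset.range N, (χ ξ : ℂ) * σc m ξ)) := by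
      convert (h.isSymbol_remainder hχ N).pd j using 1
      simp only [Complex.sub_re, Complex.one_re]
      ring
    have h2 : IsSymbol ((a - 1).re - N) (fun ξ => ∑ m ∈ Finset.range N,
        _root_.pd j (fun ξ => (χ ξ : ℂ)) ξ * σc m ξ) :=
      IsSymbol.sum fun m _ => IsSymbol.of_eq_zero_of_one_lt_norm _
        (contDiff_mul_of_zero_near (hχ.contDiff_ofReal.pd j) (hχ.pd_eventuallyEq_zero j)
          (h.comp_smooth m)) fun ξ hξ => by rw [hχ.pd_eq_zero j hξ, zero_mul]
    convert h1.add h2 using 2 with ξ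
    have h3 : _root_.pd j (fun ξ => σ ξ - ∑ m ∈ Finset.range N, (χ ξ : ℂ) * σc m ξ) ξ =
        _root_.pd j σ ξ - ∑ m ∈ Finset.range N,
          _root_.pd j (fun ξ => (χ ξ : ℂ) * σc m ξ) ξ := by
      have hd : ∀ m ∈ Finset.range N, DifferentiableAt ℝ (fun ξ => (χ ξ : ℂ) * σc m ξ) ξ :=
        fun m _ => (h.contDiff_cutoff_mul hχ m).differentiable_top ξ
      simp only [_root_.pd]
      rw [fderiv_fun_sub (h.smooth.differentiable_top ξ) (DifferentiableAt.fun_sum hd),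
        fderiv_fun_sum hd]
      simp
    rw [h3]
    simp only [pd_mul_of_zero_near hχ.contDiff_ofReal hχ.ofReal_eventuallyEq_zero
      (h.comp_smooth _), Finset.sum_add_distrib]
    ring

lemma pd_iterate (h : IsCS χ a σ σc) (hχ : IsCutoff χ) (j : Fin n) (i : ℕ) :
    IsCS χ (a - i) ((_root_.pd j)^[i] σ) (fun m => (_root_.pd j)^[i] (σc m)) := by
  induction i with
  | zero => simpa using h
  | succ i ih =>
    simp only [Function.iterate_succ_apply']
    convert ih.pd hχ j using 1
    push_cast
    ring

/-- A smooth function with an asymptotic expansion in classical symbols of integrally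
decreasing orders is a classical symbol. -/
lemma of_asymptotic {F : Euc n → ℂ} {G : ℕ → Euc n → ℂ} {g : ℕ → ℕ → Euc n → ℂ}
    (hχ : IsCutoff χ) (hG : ∀ i : ℕ, IsCS χ (a - i) (G i) (g i))
    (hF : ∀ N : ℕ, IsSymbol (a.re - N) (fun ξ => F ξ - ∑ i ∈ Finset.range N, G i ξ)) :
    IsCS χ a F (fun m ξ => ∑ i ∈ Finset.range (m + 1), g i (m - i) ξ) := by
  refine of_isSymbol_remainder (by simpa using (hF 0).smooth)
    (fun m => ContDiffOn.sum fun i _ => (hG i).comp_smooth (m - i))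
    (fun m t ht ξ hξ => ?_) fun N => ?_
  · rw [Finset.mul_sum]
    refine Finset.sum_congr rfl fun i hi => ?_
    rw [(hG i).comp_homog (m - i) t ht ξ hξ,
      Nat.cast_sub (Nat.lt_succ_iff.1 (Finset.mem_range.1 hi)), sub_sub_sub_cancel_right]
  · have h1 : IsSymbol (a.re - N) (fun ξ => ∑ i ∈ Finset.range N,
        (G i ξ - ∑ j ∈ Finset.range (N - i), (χ ξ : ℂ) * g i j ξ)) :=
      IsSymbol.sum fun i hi => by
        convert (hG i).isSymbol_remainder hχ (N - i) using 1
        rw [Nat.cast_sub (Finset.mem_range.1 hi).le]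
        simp
    convert (hF N).add h1 using 2 with ξ
    have := Finset.sum_range_diag_flip N (fun i j => (χ ξ : ℂ) * g i j ξ)
    simp only [Finset.mul_sum, Finset.sum_sub_distrib]
    rw [this]
    ring

lemma segAvg (h : IsCS χ a σ σc) (hχ : IsCutoff χ) (j : Fin n) (s : ℝ) (k : ℕ) :
    ∃ τc, IsCS χ a (segAvg k (EuclideanSpace.single j s) σ) τc := by
  refine ⟨_, of_asymptotic hχ
    (G := fun i ξ => (s ^ i / ((k + 1 + i).factorial : ℂ)) * (_root_.pd j)^[i] σ ξ)
    (fun i => (h.pd_iterate hχ j i).const_mul hχ _) fun N => ?_⟩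
  have h1 : IsSymbol (a.re - N) ((_root_.pd j)^[N] σ) := by
    simpa using (h.pd_iterate hχ j N).isSymbol hχ
  convert (h1.segAvg (k + N) (EuclideanSpace.single j s)).const_mul (s ^ N : ℂ) using 2 with ξ
  rw [segAvg_single_expansion h.smooth j s k N, add_sub_cancel_left]

end IsCS

/-- A polynomial expression in a real variable which is constant has no linear term. -/
lemma coeff_one_eq_zero_of_real_sum_eq {N : ℕ} (hN : 1 < N) (c : ℕ → ℂ) (d : ℂ)
    (h : ∀ s : ℝ, ∑ k ∈ Finset.range N, (s : ℂ) ^ k * c k = d) : c 1 = 0 := by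
  let p : Polynomial ℂ :=
    ∑ k ∈ Finset.range N, Polynomial.C (c k) * Polynomial.X ^ k - Polynomial.C d
  have hp : p = 0 := by
    refine Polynomial.eq_zero_of_infinite_isRoot p
      ((Set.infinite_range_of_injective Complex.ofReal_injective).mono ?_)
    rintro _ ⟨s, rfl⟩
    have := h s
    simp only [Set.mem_ofPred_eq, Polynomial.IsRoot, p, Polynomial.eval_sub,
      Polynomial.eval_finsetSum, Polynomial.eval_mul, Polynomial.eval_C, Polynomial.eval_pow,
      Polynomial.eval_X]
    rw [← this, sub_eq_zero]
    exact Finset.sum_congr rfl fun k _ => mul_comm _ _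
  have h1 := congrArg (fun q : Polynomial ℂ => q.coeff 1) hp
  simpa [p, Polynomial.finsetSum_coeff, Polynomial.coeff_X_pow, Polynomial.coeff_C, hN] using h1

/-- **Stokes' property versus translation invariance.** For a linear form on the span of
a translation- and derivative-stable set `S` of classical symbols containing all symbols
of order of real part `< -K`, which vanishes on derivatives of order of real part `< -K`,
closedness is equivalent to translation invariance. -/
theorem stokes_iff_translation_invariant {n : ℕ} (hn : 2 ≤ n) {χ : Euc n → ℝ}
    (hχ : IsCutoff χ) (K : ℝ) (hK : 0 < K) (S : Set (Euc n → ℂ))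
    (hSsymb : ∀ σ ∈ S, ∃ a σc, IsCS χ a σ σc)
    (hTrans : ∀ σ ∈ S, ∀ η : Euc n, (fun ξ => σ (ξ + η)) ∈ S)
    (hDeriv : ∀ σ ∈ S, ∀ j : Fin n, pd j σ ∈ S)
    (hContain : ∀ (σ : Euc n → ℂ) (a : ℂ) (σc : ℕ → Euc n → ℂ),
      IsCS χ a σ σc → a.re < -K → σ ∈ S)
    (ρ : Submodule.span ℂ S →ₗ[ℂ] ℂ)
    (hlow : ∀ σ (hσ : σ ∈ S) (j : Fin n),
      (∃ a σc, IsCS χ a (pd j σ) σc ∧ a.re < -K) →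
      ρ ⟨pd j σ, Submodule.subset_span (hDeriv σ hσ j)⟩ = 0) :
    (∀ σ (hσ : σ ∈ S) (j : Fin n),
        ρ ⟨pd j σ, Submodule.subset_span (hDeriv σ hσ j)⟩ = 0) ↔
    (∀ σ (hσ : σ ∈ S) (η : Euc n),
        ρ ⟨fun ξ => σ (ξ + η), Submodule.subset_span (hTrans σ hσ η)⟩
          = ρ ⟨σ, Submodule.subset_span hσ⟩) := by
  obtain ⟨ρ', hρ'⟩ := LinearMap.exists_extend ρ
  have hρ : ∀ (f : Euc n → ℂ) (hf : f ∈ Submodule.span ℂ S), ρ ⟨f, hf⟩ = ρ' f := fun f hf => by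
    rw [← hρ']
    rfl
  simp only [hρ] at hlow ⊢
  have hIter : ∀ σ ∈ S, ∀ (j : Fin n) (i : ℕ), (pd j)^[i] σ ∈ S := fun σ hσ j i => by
    induction i with
    | zero => exact hσ
    | succ i ih => rw [Function.iterate_succ_apply']; exact hDeriv _ ih j
  have hTaylor : ∀ σ ∈ S, ∀ j : Fin n, ∃ N, 1 < N ∧ ∀ s : ℝ,
      ρ' (fun ξ => σ (ξ + EuclideanSpace.single j s)) =
        ∑ k ∈ Finset.range N, (s : ℂ) ^ k * ((k.factorial : ℂ)⁻¹ * ρ' ((pd j)^[k] σ)) := by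
    intro σ hσ j
    obtain ⟨a, σc, h⟩ := hSsymb σ hσ
    obtain ⟨M, hM⟩ := exists_nat_gt (a.re + K)
    refine ⟨M + 1 + 1, by omega, fun s => ?_⟩
    obtain ⟨τc, hτ⟩ := (h.pd_iterate hχ j (M + 1)).segAvg hχ j s (M + 1)
    have hre : (a - ((M + 1 : ℕ) : ℂ)).re < -K := by
      rw [Complex.sub_re, Complex.natCast_re]
      push_cast
      linarith
    have hτS := hContain _ _ _ hτ hre
    have hzero := hlow _ hτS j ⟨_, _, hτ.pd hχ j, by
      rw [Complex.sub_re, Complex.one_re]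
      linarith⟩
    have hexp : (fun ξ => σ (ξ + EuclideanSpace.single j s)) =
        ∑ i ∈ Finset.range (M + 1 + 1), ((s : ℂ) ^ i / (i.factorial : ℂ)) • (pd j)^[i] σ +
          ((s : ℂ) ^ (M + 1 + 1)) •
            pd j (segAvg (M + 1) (EuclideanSpace.single j s) ((pd j)^[M + 1] σ)) := by
      funext ξ
      rw [translate_single_expansion h.smooth j s (M + 1) ξ]
      simp [Finset.sum_apply]
    rw [hexp, map_add, map_smul, hzero, smul_zero, add_zero, map_sum]
    refine Finset.sum_congr rfl fun k _ => ?_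
    rw [map_smul, smul_eq_mul]
    ring
  constructor
  · intro hclosed σ hσ η
    have hsingle : ∀ τ ∈ S, ∀ (j : Fin n) (s : ℝ),
        ρ' (fun ξ => τ (ξ + EuclideanSpace.single j s)) = ρ' τ := by
      intro τ hτ j s
      obtain ⟨N, hN, h⟩ := hTaylor τ hτ j
      rw [h s, Finset.sum_eq_single_of_mem 0 (Finset.mem_range.2 (by omega))]
      · simp
      · intro k _ hk
        obtain ⟨m, rfl⟩ := Nat.exists_eq_succ_of_ne_zero hk
        rw [Function.iterate_succ_apply', hclosed _ (hIter τ hτ j m) j, mul_zero, mul_zero]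
    have hsum : ∀ T : Finset (Fin n),
        ρ' (fun ξ => σ (ξ + ∑ i ∈ T, EuclideanSpace.single i (η i))) = ρ' σ := by
      intro T
      induction T using Finset.induction_on with
      | empty => simp
      | insert i T hi ih =>
        rw [← ih, ← hsingle _ (hTrans σ hσ (∑ i ∈ T, EuclideanSpace.single i (η i))) i (η i)]
        simp only [Finset.sum_insert hi, add_assoc]
    have hη : ∑ i, EuclideanSpace.single i (η i) = η := by
      ext m
      simp [Finset.sum_apply, Pi.single_apply]
    have := hsum Finset.univ
    rwa [hη] at this
  · intro htrans σ hσ j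
    obtain ⟨N, hN, h⟩ := hTaylor σ hσ j
    have := coeff_one_eq_zero_of_real_sum_eq hN _ (ρ' σ) fun s =>
      (h s).symm.trans (htrans σ hσ (EuclideanSpace.single j s))
    simpa using this

end
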